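/- Let g be smooth on Ω and let z ∈ C^∞(Ω) be a solution of Darboux's equation on Ω with |∇_g z|² < 1 everywhere on Ω. Then for every point q ∈ Ω there exist an open neighborhood U ⊆ Ω of q and functions z₁, z₂ ∈ C^∞(U) such that ∂_i z₁ ∂_j z₁ + ∂_i z₂ ∂_j z₂ + ∂_i z ∂_j z = g_ij on U for all i,j = 1,2; that is, F = (z₁, z₂, z) is a local isometric embedding of g into ℝ³. -/

import Mathlib

open Real Set Filter Topology

noncomputable section

/-- Partial derivative of `f : ℝ × ℝ → ℝ` in coordinate direction `i`. -/
def pd (i : Fin 2) (f : ℝ × ℝ → ℝ) (p : ℝ × ℝ) : ℝ :=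
  fderiv ℝ f p (if i = 0 then (1, 0) else (0, 1))

/-- The metric components as a 2×2 symmetric matrix of functions. -/
def gmat (g11 g12 g22 : ℝ × ℝ → ℝ) (i j : Fin 2) : ℝ × ℝ → ℝ :=
  if i = 0 then (if j = 0 then g11 else g12) else (if j = 0 then g12 else g22)

/-- The determinant of the metric. -/
def gdet (g11 g12 g22 : ℝ × ℝ → ℝ) (p : ℝ × ℝ) : ℝ :=
  g11 p * g22 p - g12 p ^ 2

/-- Components of the inverse metric. -/
def ginv (g11 g12 g22 : ℝ × ℝ → ℝ) (i j : Fin 2) (p : ℝ × ℝ) : ℝ :=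
  (if i = 0 then (if j = 0 then g22 p else -g12 p)
   else (if j = 0 then -g12 p else g11 p)) / gdet g11 g12 g22 p

/-- Christoffel symbols Γˡ_{ij}. -/
def Chr (g11 g12 g22 : ℝ × ℝ → ℝ) (l i j : Fin 2) (p : ℝ × ℝ) : ℝ :=
  (1 / 2) * ∑ m : Fin 2, ginv g11 g12 g22 l m p *
    (pd i (gmat g11 g12 g22 j m) p + pd j (gmat g11 g12 g22 i m) p
      - pd m (gmat g11 g12 g22 i j) p)

/-- Second covariant derivatives ∇_{ij} z. -/
def cov2 (g11 g12 g22 z : ℝ × ℝ → ℝ) (i j : Fin 2) (p : ℝ × ℝ) : ℝ :=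
  pd i (pd j z) p - ∑ l : Fin 2, Chr g11 g12 g22 l i j p * pd l z p

/-- |∇_g z|². -/
def gradSq (g11 g12 g22 z : ℝ × ℝ → ℝ) (p : ℝ × ℝ) : ℝ :=
  ∑ i : Fin 2, ∑ j : Fin 2, ginv g11 g12 g22 i j p * pd i z p * pd j z p

/-- The Gaussian curvature of the metric g. -/
def GaussK (g11 g12 g22 : ℝ × ℝ → ℝ) (p : ℝ × ℝ) : ℝ :=
  (1 / gdet g11 g12 g22 p) * ∑ i : Fin 2, gmat g11 g12 g22 0 i p *
    (pd 0 (Chr g11 g12 g22 i 1 1) p - pd 1 (Chr g11 g12 g22 i 0 1) p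
      + ∑ j : Fin 2, (Chr g11 g12 g22 j 1 1 p * Chr g11 g12 g22 i j 0 p
          - Chr g11 g12 g22 j 0 1 p * Chr g11 g12 g22 i j 1 p))

/-- Darboux's equation at a point p. -/
def DarbouxEq (g11 g12 g22 z : ℝ × ℝ → ℝ) (p : ℝ × ℝ) : Prop :=
  cov2 g11 g12 g22 z 0 0 p * cov2 g11 g12 g22 z 1 1 p
      - cov2 g11 g12 g22 z 0 1 p * cov2 g11 g12 g22 z 1 0 p
    = GaussK g11 g12 g22 p * gdet g11 g12 g22 p * (1 - gradSq g11 g12 g22 z p)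

/-- A smooth Riemannian metric on Ω. -/
def IsMetricOn (g11 g12 g22 : ℝ × ℝ → ℝ) (Ω : Set (ℝ × ℝ)) : Prop :=
  ContDiffOn ℝ (⊤ : ℕ∞) g11 Ω ∧ ContDiffOn ℝ (⊤ : ℕ∞) g12 Ω ∧ ContDiffOn ℝ (⊤ : ℕ∞) g22 Ω ∧
  ∀ p ∈ Ω, 0 < g11 p ∧ 0 < gdet g11 g12 g22 p

/-- The centers q_n = (1/n, 0). -/
def qpt (n : ℕ) : ℝ × ℝ := (1 / (n : ℝ), 0)

/-- Half-width of the square Xⁿ (whose width is 1/(2n(n+1))). -/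
def halfw (n : ℕ) : ℝ := 1 / (4 * (n : ℝ) * ((n : ℝ) + 1))

/-- The open axis-parallel square Xⁿ centered at q_n of width 1/(2n(n+1)). -/
def sqX (n : ℕ) : Set (ℝ × ℝ) :=
  {p | |p.1 - 1 / (n : ℝ)| < halfw n ∧ |p.2| < halfw n}

/-- The square X = (-1,1) × (-1,1). -/
def Xset : Set (ℝ × ℝ) := Ioo (-1 : ℝ) 1 ×ˢ Ioo (-1 : ℝ) 1

/-- φ is C^∞ on the closure of X, vanishes to infinite order on ∂X, and has a sign on X. -/
def PhiAdmissible (φ : ℝ × ℝ → ℝ) : Prop :=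
  ContDiffOn ℝ (⊤ : ℕ∞) φ (closure Xset) ∧
  (∀ k : ℕ, ∀ p ∈ frontier Xset, iteratedFDerivWithin ℝ k φ (closure Xset) p = 0) ∧
  ((∀ p ∈ Xset, 0 < φ p) ∨ (∀ p ∈ Xset, φ p < 0))

/-- K is obtained from φ and the sequence γ by the construction of the paper. -/
def Kconstr (φ : ℝ × ℝ → ℝ) (γ : ℕ → ℝ) (K : ℝ × ℝ → ℝ) : Prop :=
  (∀ n : ℕ, 1 ≤ n → ∀ q ∈ closure (sqX n),
      K q = γ n * φ ((4 * (n : ℝ) * ((n : ℝ) + 1)) • (q - qpt n))) ∧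
  (∀ q : ℝ × ℝ, q ∉ ⋃ n ∈ {m : ℕ | 1 ≤ m}, sqX n → K q = 0)

/-- Right vertical side +v_n of ∂Xⁿ. -/
def vSideR (n : ℕ) : Set (ℝ × ℝ) :=
  {p | p.1 = 1 / (n : ℝ) + halfw n ∧ |p.2| ≤ halfw n}

/-- Left vertical side -v_n of ∂Xⁿ. -/
def vSideL (n : ℕ) : Set (ℝ × ℝ) :=
  {p | p.1 = 1 / (n : ℝ) - halfw n ∧ |p.2| ≤ halfw n}

/-- Top horizontal side +h_n of ∂Xⁿ. -/
def hSideT (n : ℕ) : Set (ℝ × ℝ) :=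
  {p | p.2 = halfw n ∧ |p.1 - 1 / (n : ℝ)| ≤ halfw n}

/-- Bottom horizontal side -h_n of ∂Xⁿ. -/
def hSideB (n : ℕ) : Set (ℝ × ℝ) :=
  {p | p.2 = -halfw n ∧ |p.1 - 1 / (n : ℝ)| ≤ halfw n}

/-- At the point p there is a C³ change of coordinates Φ(x,y) = (x - p¹, s(x,y)) on a
neighborhood U ⊆ Ω of p, a C² function u and a positive continuous f on Φ(U), solving
∂_tt u + (K ∘ Φ⁻¹) ∂_ss u = (K ∘ Φ⁻¹) f on Φ(U). -/
def GoodChartAt (K : ℝ × ℝ → ℝ) (Ω : Set (ℝ × ℝ)) (p : ℝ × ℝ) : Prop :=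
  ∃ (U : Set (ℝ × ℝ)) (s : ℝ × ℝ → ℝ) (Ψ : ℝ × ℝ → ℝ × ℝ) (u f : ℝ × ℝ → ℝ),
    IsOpen U ∧ p ∈ U ∧ U ⊆ Ω ∧ ContDiffOn ℝ 3 s U ∧
    IsOpen ((fun q => (q.1 - p.1, s q)) '' U) ∧
    ContDiffOn ℝ 3 Ψ ((fun q => (q.1 - p.1, s q)) '' U) ∧
    (∀ q ∈ U, Ψ (q.1 - p.1, s q) = q) ∧
    (∀ w ∈ (fun q => (q.1 - p.1, s q)) '' U, ((Ψ w).1 - p.1, s (Ψ w)) = w) ∧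
    ContDiffOn ℝ 2 u ((fun q => (q.1 - p.1, s q)) '' U) ∧
    ContinuousOn f ((fun q => (q.1 - p.1, s q)) '' U) ∧
    (∀ w ∈ (fun q => (q.1 - p.1, s q)) '' U, 0 < f w) ∧
    (∀ w ∈ (fun q => (q.1 - p.1, s q)) '' U,
      pd 0 (pd 0 u) w + K (Ψ w) * pd 1 (pd 1 u) w = K (Ψ w) * f w)



/-! ### Calculus of the partial derivatives `pd` -/

section Calculus

variable {Ω : Set (ℝ × ℝ)} {f g : ℝ × ℝ → ℝ} {p : ℝ × ℝ}

lemma ContDiffOn.differentiableAt_of_isOpen (hf : ContDiffOn ℝ (⊤ : ℕ∞) f Ω) (hΩ : IsOpen Ω)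
    (hp : p ∈ Ω) : DifferentiableAt ℝ f p :=
  (hf.differentiableOn (by simp)).differentiableAt (hΩ.mem_nhds hp)

lemma ContDiffOn.pd (hf : ContDiffOn ℝ (⊤ : ℕ∞) f Ω) (hΩ : IsOpen Ω) (i : Fin 2) :
    ContDiffOn ℝ (⊤ : ℕ∞) (pd i f) Ω :=
  ((contDiffOn_infty_iff_fderiv_of_isOpen hΩ).1 hf).2.clm_apply contDiffOn_const

lemma pd_congr (hΩ : IsOpen Ω) (h : ∀ x ∈ Ω, f x = g x) (hp : p ∈ Ω) (i : Fin 2) :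
    pd i f p = pd i g p := by
  have : f =ᶠ[𝓝 p] g := by filter_upwards [hΩ.mem_nhds hp] with x hx using h x hx
  rw [pd, pd, this.fderiv_eq]

lemma pd_add (hf : DifferentiableAt ℝ f p) (hg : DifferentiableAt ℝ g p) (i : Fin 2) :
    pd i (fun x => f x + g x) p = pd i f p + pd i g p := by
  simp [pd, fderiv_fun_add hf hg]

lemma pd_sub (hf : DifferentiableAt ℝ f p) (hg : DifferentiableAt ℝ g p) (i : Fin 2) :
    pd i (fun x => f x - g x) p = pd i f p - pd i g p := by
  simp [pd, fderiv_fun_sub hf hg]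

lemma pd_mul (hf : DifferentiableAt ℝ f p) (hg : DifferentiableAt ℝ g p) (i : Fin 2) :
    pd i (fun x => f x * g x) p = pd i f p * g p + f p * pd i g p := by
  simp [pd, fderiv_fun_mul hf hg]
  ring

lemma pd_const_mul (hf : DifferentiableAt ℝ f p) (c : ℝ) (i : Fin 2) :
    pd i (fun x => c * f x) p = c * pd i f p := by
  simp [pd, fderiv_const_mul hf]

lemma pd_cos (hf : DifferentiableAt ℝ f p) (i : Fin 2) :
    pd i (fun x => Real.cos (f x)) p = -Real.sin (f p) * pd i f p := by
  simp [pd, fderiv_cos hf]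

lemma pd_sin (hf : DifferentiableAt ℝ f p) (i : Fin 2) :
    pd i (fun x => Real.sin (f x)) p = Real.cos (f p) * pd i f p := by
  simp [pd, fderiv_sin hf]

lemma fderiv_apply_eq_pd (f : ℝ × ℝ → ℝ) (p v : ℝ × ℝ) :
    fderiv ℝ f p v = v.1 * pd 0 f p + v.2 * pd 1 f p := by
  have : v = v.1 • ((1, 0) : ℝ × ℝ) + v.2 • ((0, 1) : ℝ × ℝ) := by ext <;> simp
  rw [congrArg (fderiv ℝ f p) this, map_add, map_smul, map_smul]
  simp [pd]

lemma pd_comm (hf : ContDiffOn ℝ (⊤ : ℕ∞) f Ω) (hΩ : IsOpen Ω) (hp : p ∈ Ω) (i j : Fin 2) :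
    pd i (pd j f) p = pd j (pd i f) p := by
  have hd : DifferentiableAt ℝ (fderiv ℝ f) p :=
    (((contDiffOn_infty_iff_fderiv_of_isOpen hΩ).1 hf).2.differentiableOn
      (by simp)).differentiableAt (hΩ.mem_nhds hp)
  have hs : IsSymmSndFDerivAt ℝ f p :=
    (hf.contDiffAt (hΩ.mem_nhds hp)).isSymmSndFDerivAt (by
      rw [minSmoothness_of_isRCLikeNormedField]
      exact WithTop.coe_le_coe.2 le_top)
  have key : ∀ k l : Fin 2, pd k (pd l f) p = fderiv ℝ (fderiv ℝ f) p
      (if k = 0 then (1, 0) else (0, 1)) (if l = 0 then (1, 0) else (0, 1)) := by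
    intro k l
    have : fderiv ℝ (pd l f) p = _ :=
      fderiv_clm_apply hd (differentiableAt_const (if l = 0 then ((1, 0) : ℝ × ℝ) else (0, 1)))
    rw [pd, this]
    simp
  rw [key, key, hs.eq]

/-- Poincaré's lemma for smooth `1`-forms on a convex open subset of the plane. -/
lemma exists_pd_eq_of_pd_eq (hΩ : IsOpen Ω) (hc : Convex ℝ Ω)
    (hf : ContDiffOn ℝ (⊤ : ℕ∞) f Ω) (hg : ContDiffOn ℝ (⊤ : ℕ∞) g Ω)
    (h : ∀ x ∈ Ω, pd 1 f x = pd 0 g x) :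
    ∃ u : ℝ × ℝ → ℝ, ContDiffOn ℝ (⊤ : ℕ∞) u Ω ∧ ∀ x ∈ Ω, pd 0 u x = f x ∧ pd 1 u x = g x := by
  set ω : ℝ × ℝ → (ℝ × ℝ →L[ℝ] ℝ) := fun x =>
    f x • ContinuousLinearMap.fst ℝ ℝ ℝ + g x • ContinuousLinearMap.snd ℝ ℝ ℝ with hω
  have hωs : ContDiffOn ℝ (⊤ : ℕ∞) ω Ω :=
    (hf.smul contDiffOn_const).add (hg.smul contDiffOn_const)
  obtain ⟨u, hu⟩ := hc.exists_forall_hasFDerivAt_of_fderiv_symmetric hΩ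
    (hωs.differentiableOn (by simp)) (by
      intro x hx v w
      have hfx := hf.differentiableAt_of_isOpen hΩ hx
      have hgx := hg.differentiableAt_of_isOpen hΩ hx
      have : HasFDerivAt ω _ x := (hfx.hasFDerivAt.smul_const (ContinuousLinearMap.fst ℝ ℝ ℝ)).add
        (hgx.hasFDerivAt.smul_const (ContinuousLinearMap.snd ℝ ℝ ℝ))
      rw [this.fderiv]
      simp only [add_apply, ContinuousLinearMap.smulRight_apply,
        smul_apply, ContinuousLinearMap.coe_fst', ContinuousLinearMap.coe_snd',
        smul_eq_mul, fderiv_apply_eq_pd, h x hx]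
      ring)
  refine ⟨u, (contDiffOn_infty_iff_fderiv_of_isOpen hΩ).2
    ⟨fun x hx => (hu x hx).differentiableAt.differentiableWithinAt,
      hωs.congr fun x hx => (hu x hx).fderiv⟩, fun x hx => ?_⟩
  simp [pd, (hu x hx).fderiv, hω]

lemma pd_pd_congr (hΩ : IsOpen Ω) (h : ∀ x ∈ Ω, f x = g x) (hp : p ∈ Ω) (i j : Fin 2) :
    pd i (pd j f) p = pd i (pd j g) p :=
  pd_congr hΩ (fun _ hx => pd_congr hΩ h hx j) hp i

lemma pd_pd_add (hΩ : IsOpen Ω) (hf : ContDiffOn ℝ (⊤ : ℕ∞) f Ω)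
    (hg : ContDiffOn ℝ (⊤ : ℕ∞) g Ω) (hp : p ∈ Ω) (i j : Fin 2) :
    pd i (pd j (fun x => f x + g x)) p = pd i (pd j f) p + pd i (pd j g) p := by
  rw [pd_congr hΩ (fun x hx => pd_add (hf.differentiableAt_of_isOpen hΩ hx)
      (hg.differentiableAt_of_isOpen hΩ hx) j) hp i,
    pd_add ((hf.pd hΩ j).differentiableAt_of_isOpen hΩ hp)
      ((hg.pd hΩ j).differentiableAt_of_isOpen hΩ hp)]

lemma pd_pd_mul (hΩ : IsOpen Ω) (hf : ContDiffOn ℝ (⊤ : ℕ∞) f Ω)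
    (hg : ContDiffOn ℝ (⊤ : ℕ∞) g Ω) (hp : p ∈ Ω) (i j : Fin 2) :
    pd i (pd j (fun x => f x * g x)) p = pd i (pd j f) p * g p + pd j f p * pd i g p
      + (pd i f p * pd j g p + f p * pd i (pd j g) p) := by
  have df := hf.differentiableAt_of_isOpen hΩ hp
  have dg := hg.differentiableAt_of_isOpen hΩ hp
  have df' := (hf.pd hΩ j).differentiableAt_of_isOpen hΩ hp
  have dg' := (hg.pd hΩ j).differentiableAt_of_isOpen hΩ hp
  rw [pd_congr hΩ (fun x hx => pd_mul (hf.differentiableAt_of_isOpen hΩ hx)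
      (hg.differentiableAt_of_isOpen hΩ hx) j) hp i,
    pd_add (df'.fun_mul dg) (df.fun_mul dg'), pd_mul df' dg, pd_mul df dg']

end Calculus

/-- The Gauss equation for the graph direction: if `z` solves Darboux's equation pointwise, then
the metric `g - dz ⊗ dz` is flat. Here `e, f, g` is the metric, `(l₁, l₂)`, `(m₁, m₂)`, `(n₁, n₂)`
are the Christoffel symbols of the first kind, `W`, `Y`, `X` those of the second kind, and `L` is
the part of the curvature that is linear in the second derivatives of the metric. -/
lemma flat_of_darboux_pointwise {e f g p q L l₁ l₂ m₁ m₂ n₁ n₂ W₀ W₁ Y₀ Y₁ X₀ X₁ r s t σ : ℝ}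
    (hW₀ : e * W₀ + f * W₁ = l₁) (hW₁ : f * W₀ + g * W₁ = l₂)
    (hY₀ : e * Y₀ + f * Y₁ = m₁) (hY₁ : f * Y₀ + g * Y₁ = m₂)
    (hX₀ : e * X₀ + f * X₁ = n₁) (hX₁ : f * X₀ + g * X₁ = n₂)
    (hσ : σ * (e * g - f ^ 2) = g * p ^ 2 - 2 * f * p * q + e * q ^ 2)
    (hD : (r - (W₀ * p + W₁ * q)) * (t - (X₀ * p + X₁ * q)) - (s - (Y₀ * p + Y₁ * q)) ^ 2 =
      (L + (m₁ * Y₀ + m₂ * Y₁) - (l₁ * X₀ + l₂ * X₁)) * (1 - σ)) :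
    ((e - p ^ 2) * (g - q ^ 2) - (f - p * q) ^ 2) * (L + s ^ 2 - r * t)
      + ((g - q ^ 2) * (m₁ - s * p) ^ 2 - 2 * (f - p * q) * (m₁ - s * p) * (m₂ - s * q)
        + (e - p ^ 2) * (m₂ - s * q) ^ 2)
      - ((g - q ^ 2) * (l₁ - r * p) * (n₁ - t * p)
        - (f - p * q) * ((l₁ - r * p) * (n₂ - t * q) + (l₂ - r * q) * (n₁ - t * p))
        + (e - p ^ 2) * (l₂ - r * q) * (n₂ - t * q)) = 0 := by
  subst hW₀ hW₁ hY₀ hY₁ hX₀ hX₁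
  linear_combination (-(e * g - f ^ 2)) * hD +
    (L + ((e * Y₀ + f * Y₁) * Y₀ + (f * Y₀ + g * Y₁) * Y₁)
      - ((e * W₀ + f * W₁) * X₀ + (f * W₀ + g * W₁) * X₁)) * hσ

lemma flat_frame_pointwise {a b c ax ay bx bY cx cy axy ayy bxx bxy cxx P Q Px Py Qx : ℝ}
    (ha : a ≠ 0) (hc : c ≠ 0)
    (hP : P * c = bx - ay) (hQ : Q * a = cx + P * b)
    (hPx : Px * c + P * cx = bxx - axy) (hPy : Py * c + P * cy = bxy - ayy)
    (hQx : Qx * a + Q * ax = cxx + (Px * b + P * bx))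
    (h : (a ^ 2 * (b ^ 2 + c ^ 2) - (a * b) ^ 2) *
        ((axy * b + ay * bx + ax * bY + a * bxy) - (ay ^ 2 + a * ayy)
          - (bx ^ 2 + b * bxx + cx ^ 2 + c * cxx))
      + ((b ^ 2 + c ^ 2) * (a * ay) ^ 2 - 2 * (a * b) * (a * ay) * (b * bx + c * cx)
        + a ^ 2 * (b * bx + c * cx) ^ 2)
      - ((b ^ 2 + c ^ 2) * (a * ax) * (ay * b + a * bY - (b * bx + c * cx))
        - (a * b) * ((a * ax) * (b * bY + c * cy)
          + (ax * b + a * bx - a * ay) * (ay * b + a * bY - (b * bx + c * cx)))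
        + a ^ 2 * (ax * b + a * bx - a * ay) * (b * bY + c * cy)) = 0) :
    Py = Qx := by
  obtain rfl : P = (bx - ay) / c := by field_simp; linarith
  obtain rfl : Q = (cx + (bx - ay) / c * b) / a := by field_simp at hQ ⊢; linarith
  obtain rfl : Px = (bxx - axy - (bx - ay) / c * cx) / c := by field_simp at hPx ⊢; linarith
  have : a ^ 3 * c ^ 3 * (Py - Qx) = 0 := by
    obtain rfl : Py = (bxy - ayy - (bx - ay) / c * cy) / c := by field_simp at hPy ⊢; linarith
    obtain rfl : Qx = (cxx + ((bxx - axy - (bx - ay) / c * cx) / c * b + (bx - ay) / c * bx)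
      - (cx + (bx - ay) / c * b) / a * ax) / a := by field_simp at hQx ⊢; linarith
    field_simp
    linear_combination h
  simpa [ha, hc, sub_eq_zero] using this

/-! ### Christoffel symbols and curvature -/

section Metric

variable {Ω : Set (ℝ × ℝ)} {g11 g12 g22 : ℝ × ℝ → ℝ} {p : ℝ × ℝ}

lemma Chr_symm (l i j : Fin 2) : Chr g11 g12 g22 l i j = Chr g11 g12 g22 l j i := by
  have h : gmat g11 g12 g22 i j = gmat g11 g12 g22 j i := by
    fin_cases i <;> fin_cases j <;> rfl
  funext p
  simp only [Chr, h, add_comm]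

lemma lower_Chr_zero (h : gdet g11 g12 g22 p ≠ 0) (i j : Fin 2) :
    g11 p * Chr g11 g12 g22 0 i j p + g12 p * Chr g11 g12 g22 1 i j p =
      (1 / 2) * (pd i (gmat g11 g12 g22 j 0) p + pd j (gmat g11 g12 g22 i 0) p
        - pd 0 (gmat g11 g12 g22 i j) p) := by
  simp only [Chr, ginv, Fin.sum_univ_two, if_true, one_ne_zero, if_false]
  field_simp
  simp only [gdet]
  ring

lemma lower_Chr_one (h : gdet g11 g12 g22 p ≠ 0) (i j : Fin 2) :
    g12 p * Chr g11 g12 g22 0 i j p + g22 p * Chr g11 g12 g22 1 i j p =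
      (1 / 2) * (pd i (gmat g11 g12 g22 j 1) p + pd j (gmat g11 g12 g22 i 1) p
        - pd 1 (gmat g11 g12 g22 i j) p) := by
  simp only [Chr, ginv, Fin.sum_univ_two, if_true, one_ne_zero, if_false]
  field_simp
  simp only [gdet]
  ring

lemma IsMetricOn.contDiffOn_gmat (hg : IsMetricOn g11 g12 g22 Ω) (i j : Fin 2) :
    ContDiffOn ℝ (⊤ : ℕ∞) (gmat g11 g12 g22 i j) Ω := by
  obtain ⟨h1, h2, h3, -⟩ := hg
  unfold gmat
  split_ifs <;> assumption

lemma IsMetricOn.contDiffOn_gdet (hg : IsMetricOn g11 g12 g22 Ω) :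
    ContDiffOn ℝ (⊤ : ℕ∞) (gdet g11 g12 g22) Ω :=
  (hg.1.mul hg.2.2.1).sub (hg.2.1.pow 2)

lemma IsMetricOn.contDiffOn_ginv (hg : IsMetricOn g11 g12 g22 Ω) (i j : Fin 2) :
    ContDiffOn ℝ (⊤ : ℕ∞) (ginv g11 g12 g22 i j) Ω := by
  refine ContDiffOn.div ?_ hg.contDiffOn_gdet fun x hx => (hg.2.2.2 x hx).2.ne'
  obtain ⟨h1, h2, h3, -⟩ := hg
  split_ifs
  exacts [h3, h2.neg, h2.neg, h1]

lemma IsMetricOn.contDiffOn_Chr (hg : IsMetricOn g11 g12 g22 Ω) (hΩ : IsOpen Ω)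
    (l i j : Fin 2) : ContDiffOn ℝ (⊤ : ℕ∞) (Chr g11 g12 g22 l i j) Ω := by
  refine contDiffOn_const.mul (ContDiffOn.sum fun m _ => (hg.contDiffOn_ginv l m).mul ?_)
  exact (((hg.contDiffOn_gmat j m).pd hΩ i).add ((hg.contDiffOn_gmat i m).pd hΩ j)).sub
    ((hg.contDiffOn_gmat i j).pd hΩ m)

/-- The curvature in terms of the Christoffel symbols of the first and second kind. -/
lemma GaussK_mul_gdet (hg : IsMetricOn g11 g12 g22 Ω) (hΩ : IsOpen Ω) (hp : p ∈ Ω) :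
    GaussK g11 g12 g22 p * gdet g11 g12 g22 p =
      (pd 0 (pd 1 g12) p - (1 / 2) * pd 0 (pd 0 g22) p - (1 / 2) * pd 1 (pd 1 g11) p)
      + ((1 / 2) * pd 1 g11 p * Chr g11 g12 g22 0 0 1 p
        + (1 / 2) * pd 0 g22 p * Chr g11 g12 g22 1 0 1 p)
      - ((1 / 2) * pd 0 g11 p * Chr g11 g12 g22 0 1 1 p
        + (pd 0 g12 p - (1 / 2) * pd 1 g11 p) * Chr g11 g12 g22 1 1 1 p) := by
  have hdet : ∀ x ∈ Ω, gdet g11 g12 g22 x ≠ 0 := fun x hx => (hg.2.2.2 x hx).2.ne'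
  have dif : ∀ {f : ℝ × ℝ → ℝ}, ContDiffOn ℝ (⊤ : ℕ∞) f Ω → DifferentiableAt ℝ f p :=
    fun hf => hf.differentiableAt_of_isOpen hΩ hp
  have d11 := dif hg.1
  have d12 := dif hg.2.1
  have dC : ∀ l i j, DifferentiableAt ℝ (Chr g11 g12 g22 l i j) p :=
    fun l i j => dif (hg.contDiffOn_Chr hΩ l i j)
  have e00 : g11 p * Chr g11 g12 g22 0 0 0 p + g12 p * Chr g11 g12 g22 1 0 0 p =
      (1 / 2) * pd 0 g11 p := by
    rw [lower_Chr_zero (hdet p hp)]; simp [gmat]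
  have e01 : ∀ x ∈ Ω, g11 x * Chr g11 g12 g22 0 0 1 x + g12 x * Chr g11 g12 g22 1 0 1 x =
      (1 / 2) * pd 1 g11 x := by
    intro x hx; rw [lower_Chr_zero (hdet x hx)]; simp [gmat]
  have e11 : ∀ x ∈ Ω, g11 x * Chr g11 g12 g22 0 1 1 x + g12 x * Chr g11 g12 g22 1 1 1 x =
      pd 1 g12 x - (1 / 2) * pd 0 g22 x := by
    intro x hx; rw [lower_Chr_zero (hdet x hx)]; simp [gmat]; ring
  have D01 := pd_congr hΩ e01 hp 1
  have D11 := pd_congr hΩ e11 hp 0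
  rw [pd_add (d11.fun_mul (dC 0 0 1)) (d12.fun_mul (dC 1 0 1)), pd_mul d11 (dC 0 0 1),
    pd_mul d12 (dC 1 0 1), pd_const_mul (dif (hg.1.pd hΩ 1))] at D01
  rw [pd_add (d11.fun_mul (dC 0 1 1)) (d12.fun_mul (dC 1 1 1)), pd_mul d11 (dC 0 1 1),
    pd_mul d12 (dC 1 1 1), pd_sub (dif (hg.2.1.pd hΩ 1)) ((dif (hg.2.2.1.pd hΩ 0)).const_mul _),
    pd_const_mul (dif (hg.2.2.1.pd hΩ 0))] at D11
  have E01 := e01 p hp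
  have E11 := e11 p hp
  have hK : GaussK g11 g12 g22 p * gdet g11 g12 g22 p = ∑ i : Fin 2, gmat g11 g12 g22 0 i p *
    (pd 0 (Chr g11 g12 g22 i 1 1) p - pd 1 (Chr g11 g12 g22 i 0 1) p
      + ∑ j : Fin 2, (Chr g11 g12 g22 j 1 1 p * Chr g11 g12 g22 i j 0 p
          - Chr g11 g12 g22 j 0 1 p * Chr g11 g12 g22 i j 1 p)) := by
    rw [GaussK, one_div, mul_right_comm, inv_mul_cancel₀ (hdet p hp), one_mul]
  rw [hK]
  simp only [Fin.sum_univ_two, Chr_symm _ 1 0, gmat, if_true, one_ne_zero, if_false]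
  linear_combination D11 - D01 + Chr g11 g12 g22 0 1 1 p * e00
    + (Chr g11 g12 g22 1 1 1 p - Chr g11 g12 g22 0 0 1 p) * E01
    - Chr g11 g12 g22 1 0 1 p * E11

lemma gradSq_mul_gdet (z : ℝ × ℝ → ℝ) (h : gdet g11 g12 g22 p ≠ 0) :
    gradSq g11 g12 g22 z p * gdet g11 g12 g22 p =
      g22 p * pd 0 z p ^ 2 - 2 * g12 p * pd 0 z p * pd 1 z p + g11 p * pd 1 z p ^ 2 := by
  simp only [gradSq, ginv, Fin.sum_univ_two, if_true, one_ne_zero, if_false]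
  field_simp
  ring

end Metric

/-! ### The flat metric `g - dz ⊗ dz` -/

section Flat

variable {Ω : Set (ℝ × ℝ)} {g11 g12 g22 z a b c : ℝ × ℝ → ℝ}

/-- If `g - dz ⊗ dz = θ₁ ⊗ θ₁ + θ₂ ⊗ θ₂` with `θ₁ = a dx + b dy` and `θ₂ = c dy`, and `z` solves
Darboux's equation, then the connection form `P dx + Q dy` of the coframe `θ₁, θ₂` is closed. -/
lemma connection_closed_of_darboux (hΩ : IsOpen Ω) (hg : IsMetricOn g11 g12 g22 Ω)
    (hz : ContDiffOn ℝ (⊤ : ℕ∞) z Ω) (ha : ContDiffOn ℝ (⊤ : ℕ∞) a Ω)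
    (hb : ContDiffOn ℝ (⊤ : ℕ∞) b Ω) (hc : ContDiffOn ℝ (⊤ : ℕ∞) c Ω)
    (ha0 : ∀ x ∈ Ω, a x ≠ 0) (hc0 : ∀ x ∈ Ω, c x ≠ 0)
    (h11 : ∀ x ∈ Ω, g11 x = a x * a x + pd 0 z x * pd 0 z x)
    (h12 : ∀ x ∈ Ω, g12 x = a x * b x + pd 0 z x * pd 1 z x)
    (h22 : ∀ x ∈ Ω, g22 x = b x * b x + c x * c x + pd 1 z x * pd 1 z x)
    (hD : ∀ x ∈ Ω, DarbouxEq g11 g12 g22 z x) {P Q : ℝ × ℝ → ℝ}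
    (hP : ContDiffOn ℝ (⊤ : ℕ∞) P Ω) (hQ : ContDiffOn ℝ (⊤ : ℕ∞) Q Ω)
    (hPc : ∀ x ∈ Ω, P x * c x = pd 0 b x - pd 1 a x)
    (hQa : ∀ x ∈ Ω, Q x * a x = pd 0 c x + P x * b x) :
    ∀ x ∈ Ω, pd 1 P x = pd 0 Q x := by
  intro x hx
  have hdet : gdet g11 g12 g22 x ≠ 0 := (hg.2.2.2 x hx).2.ne'
  have dif : ∀ {f : ℝ × ℝ → ℝ}, ContDiffOn ℝ (⊤ : ℕ∞) f Ω → DifferentiableAt ℝ f x :=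
    fun hf => hf.differentiableAt_of_isOpen hΩ hx
  have hp := hz.pd hΩ 0
  have hq := hz.pd hΩ 1
  have e11 : ∀ i, pd i g11 x = 2 * (a x * pd i a x + pd 0 z x * pd i (pd 0 z) x) := by
    intro i
    rw [pd_congr hΩ h11 hx i, pd_add ((dif ha).fun_mul (dif ha)) ((dif hp).fun_mul (dif hp)),
      pd_mul (dif ha) (dif ha), pd_mul (dif hp) (dif hp)]
    ring
  have e12 : ∀ i, pd i g12 x = pd i a x * b x + a x * pd i b x
      + (pd i (pd 0 z) x * pd 1 z x + pd 0 z x * pd i (pd 1 z) x) := by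
    intro i
    rw [pd_congr hΩ h12 hx i, pd_add ((dif ha).fun_mul (dif hb)) ((dif hp).fun_mul (dif hq)),
      pd_mul (dif ha) (dif hb), pd_mul (dif hp) (dif hq)]
  have e22 : ∀ i, pd i g22 x =
      2 * (b x * pd i b x + c x * pd i c x + pd 1 z x * pd i (pd 1 z) x) := by
    intro i
    rw [pd_congr hΩ h22 hx i,
      pd_add (((dif hb).fun_mul (dif hb)).fun_add ((dif hc).fun_mul (dif hc)))
        ((dif hq).fun_mul (dif hq)),
      pd_add ((dif hb).fun_mul (dif hb)) ((dif hc).fun_mul (dif hc)),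
      pd_mul (dif hb) (dif hb), pd_mul (dif hc) (dif hc), pd_mul (dif hq) (dif hq)]
    ring
  have s11 := pd_pd_congr hΩ h11 hx 1 1
  rw [pd_pd_add hΩ (ha.mul ha) (hp.mul hp) hx, pd_pd_mul hΩ ha ha hx,
    pd_pd_mul hΩ hp hp hx] at s11
  have s12 := pd_pd_congr hΩ h12 hx 0 1
  rw [pd_pd_add hΩ (ha.mul hb) (hp.mul hq) hx, pd_pd_mul hΩ ha hb hx,
    pd_pd_mul hΩ hp hq hx] at s12
  have s22 := pd_pd_congr hΩ h22 hx 0 0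
  rw [pd_pd_add hΩ ((hb.mul hb).add (hc.mul hc)) (hq.mul hq) hx,
    pd_pd_add hΩ (hb.mul hb) (hc.mul hc) hx, pd_pd_mul hΩ hb hb hx,
    pd_pd_mul hΩ hc hc hx, pd_pd_mul hΩ hq hq hx] at s22
  have c1 : pd 1 (pd 0 z) x = pd 0 (pd 1 z) x := pd_comm hz hΩ hx 1 0
  have c2 : pd 1 (pd 1 (pd 0 z)) x = pd 0 (pd 1 (pd 1 z)) x := by
    rw [pd_congr hΩ (fun y hy => pd_comm hz hΩ hy 1 0) hx 1, pd_comm hq hΩ hx 1 0]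
  have c3 : pd 0 (pd 1 (pd 0 z)) x = pd 0 (pd 0 (pd 1 z)) x :=
    pd_congr hΩ (fun y hy => pd_comm hz hΩ hy 1 0) hx 0
  have hDx := hD x hx
  rw [DarbouxEq, GaussK_mul_gdet hg hΩ hx] at hDx
  simp only [cov2, Fin.sum_univ_two, Chr_symm _ 1 0, c1] at hDx
  have hflat := flat_of_darboux_pointwise
    (L := pd 0 (pd 1 g12) x - (1 / 2) * pd 0 (pd 0 g22) x - (1 / 2) * pd 1 (pd 1 g11) x)
    (r := pd 0 (pd 0 z) x) (s := pd 0 (pd 1 z) x) (t := pd 1 (pd 1 z) x)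
    (lower_Chr_zero hdet 0 0) (lower_Chr_one hdet 0 0) (lower_Chr_zero hdet 0 1)
    (lower_Chr_one hdet 0 1) (lower_Chr_zero hdet 1 1) (lower_Chr_one hdet 1 1)
    (gradSq_mul_gdet z hdet) (by
      simp only [gmat, if_true, one_ne_zero, if_false]
      linear_combination hDx)
  simp only [gmat, if_true, one_ne_zero, if_false, s11, s12, s22, e11, e12, e22, h11 x hx,
    h12 x hx, h22 x hx, c1, c2, c3] at hflat
  have hPx : ∀ i, pd i P x * c x + P x * pd i c x = pd i (pd 0 b) x - pd i (pd 1 a) x := by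
    intro i
    rw [← pd_mul (dif hP) (dif hc), pd_congr hΩ hPc hx,
      pd_sub (dif (hb.pd hΩ 0)) (dif (ha.pd hΩ 1))]
  have hQx := pd_congr hΩ hQa hx 0
  rw [pd_mul (dif hQ) (dif ha), pd_add (dif (hc.pd hΩ 0)) ((dif hP).fun_mul (dif hb)),
    pd_mul (dif hP) (dif hb)] at hQx
  refine flat_frame_pointwise (ha0 x hx) (hc0 x hx) (hPc x hx) (hQa x hx) (hPx 0)
    ((hPx 1).trans (by rw [pd_comm hb hΩ hx 1 0])) hQx (bY := pd 1 b x) (ax := pd 0 a x) ?_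
  linear_combination hflat

/-- A planar metric with orthonormal coframe `a dx + b dy`, `c dy` whose connection form is closed
is isometric to the Euclidean metric. -/
lemma exists_isometry_of_connection_closed (hΩ : IsOpen Ω) (hcv : Convex ℝ Ω)
    (ha : ContDiffOn ℝ (⊤ : ℕ∞) a Ω) (hb : ContDiffOn ℝ (⊤ : ℕ∞) b Ω)
    (hc : ContDiffOn ℝ (⊤ : ℕ∞) c Ω) {P Q : ℝ × ℝ → ℝ}
    (hP : ContDiffOn ℝ (⊤ : ℕ∞) P Ω) (hQ : ContDiffOn ℝ (⊤ : ℕ∞) Q Ω)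
    (hPc : ∀ x ∈ Ω, P x * c x = pd 0 b x - pd 1 a x)
    (hQa : ∀ x ∈ Ω, Q x * a x = pd 0 c x + P x * b x)
    (hPQ : ∀ x ∈ Ω, pd 1 P x = pd 0 Q x) :
    ∃ u v : ℝ × ℝ → ℝ, ContDiffOn ℝ (⊤ : ℕ∞) u Ω ∧ ContDiffOn ℝ (⊤ : ℕ∞) v Ω ∧
      ∀ x ∈ Ω, pd 0 u x * pd 0 u x + pd 0 v x * pd 0 v x = a x * a x ∧
        pd 0 u x * pd 1 u x + pd 0 v x * pd 1 v x = a x * b x ∧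
        pd 1 u x * pd 1 u x + pd 1 v x * pd 1 v x = b x * b x + c x * c x := by
  obtain ⟨φ, hφ, hφd⟩ := exists_pd_eq_of_pd_eq hΩ hcv hP hQ hPQ
  have hC : ContDiffOn ℝ (⊤ : ℕ∞) (fun x => Real.cos (φ x)) Ω := hφ.cos
  have hS : ContDiffOn ℝ (⊤ : ℕ∞) (fun x => Real.sin (φ x)) Ω := hφ.sin
  obtain ⟨u, hu, hud⟩ := exists_pd_eq_of_pd_eq hΩ hcv (hC.mul ha) ((hC.mul hb).sub (hS.mul hc))
    (by
      intro x hx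
      have dif : ∀ {f : ℝ × ℝ → ℝ}, ContDiffOn ℝ (⊤ : ℕ∞) f Ω → DifferentiableAt ℝ f x :=
        fun hf => hf.differentiableAt_of_isOpen hΩ hx
      rw [pd_mul (dif hC) (dif ha), pd_sub ((dif hC).fun_mul (dif hb)) ((dif hS).fun_mul (dif hc)),
        pd_mul (dif hC) (dif hb), pd_mul (dif hS) (dif hc), pd_cos (dif hφ), pd_cos (dif hφ),
        pd_sin (dif hφ), (hφd x hx).1, (hφd x hx).2]
      linear_combination Real.cos (φ x) * hPc x hx - Real.sin (φ x) * hQa x hx)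
  obtain ⟨v, hv, hvd⟩ := exists_pd_eq_of_pd_eq hΩ hcv (hS.mul ha) ((hS.mul hb).add (hC.mul hc))
    (by
      intro x hx
      have dif : ∀ {f : ℝ × ℝ → ℝ}, ContDiffOn ℝ (⊤ : ℕ∞) f Ω → DifferentiableAt ℝ f x :=
        fun hf => hf.differentiableAt_of_isOpen hΩ hx
      rw [pd_mul (dif hS) (dif ha), pd_add ((dif hS).fun_mul (dif hb)) ((dif hC).fun_mul (dif hc)),
        pd_mul (dif hS) (dif hb), pd_mul (dif hC) (dif hc), pd_sin (dif hφ), pd_sin (dif hφ),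
        pd_cos (dif hφ), (hφd x hx).1, (hφd x hx).2]
      linear_combination Real.sin (φ x) * hPc x hx + Real.cos (φ x) * hQa x hx)
  refine ⟨u, v, hu, hv, fun x hx => ?_⟩
  rw [(hud x hx).1, (hud x hx).2, (hvd x hx).1, (hvd x hx).2]
  have h1 := Real.sin_sq_add_cos_sq (φ x)
  refine ⟨?_, ?_, ?_⟩
  · linear_combination (a x * a x) * h1
  · linear_combination (a x * b x) * h1
  · linear_combination (b x * b x + c x * c x) * h1

end Flat

theorem darboux_solution_gives_isometric_embedding
    (Ω : Set (ℝ × ℝ)) (hΩ : IsOpen Ω)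
    (g11 g12 g22 : ℝ × ℝ → ℝ) (hg : IsMetricOn g11 g12 g22 Ω)
    (z : ℝ × ℝ → ℝ) (hz : ContDiffOn ℝ (⊤ : ℕ∞) z Ω)
    (hD : ∀ p ∈ Ω, DarbouxEq g11 g12 g22 z p)
    (hgrad : ∀ p ∈ Ω, gradSq g11 g12 g22 z p < 1) :
    ∀ q ∈ Ω, ∃ (U : Set (ℝ × ℝ)) (z₁ z₂ : ℝ × ℝ → ℝ),
      IsOpen U ∧ q ∈ U ∧ U ⊆ Ω ∧
      ContDiffOn ℝ (⊤ : ℕ∞) z₁ U ∧ ContDiffOn ℝ (⊤ : ℕ∞) z₂ U ∧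
      ∀ p ∈ U, ∀ i j : Fin 2,
        pd i z₁ p * pd j z₁ p + pd i z₂ p * pd j z₂ p + pd i z p * pd j z p
          = gmat g11 g12 g22 i j p := by
  intro q hq
  obtain ⟨ε, hε, hball⟩ := Metric.isOpen_iff.1 hΩ q hq
  refine ⟨Metric.ball q ε, ?_⟩
  have hU : IsOpen (Metric.ball q ε) := Metric.isOpen_ball
  have hgU : IsMetricOn g11 g12 g22 (Metric.ball q ε) :=
    ⟨hg.1.mono hball, hg.2.1.mono hball, hg.2.2.1.mono hball, fun p hp => hg.2.2.2 p (hball hp)⟩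
  have hzU := hz.mono hball
  have hzx := hzU.pd hU 0
  have hzy := hzU.pd hU 1
  set E : ℝ × ℝ → ℝ := fun x => g11 x - pd 0 z x * pd 0 z x with hE
  set F : ℝ × ℝ → ℝ := fun x => g12 x - pd 0 z x * pd 1 z x with hF
  set G : ℝ × ℝ → ℝ := fun x => g22 x - pd 1 z x * pd 1 z x with hG
  have hEs : ContDiffOn ℝ (⊤ : ℕ∞) E (Metric.ball q ε) := hgU.1.sub (hzx.mul hzx)
  have hFs : ContDiffOn ℝ (⊤ : ℕ∞) F (Metric.ball q ε) := hgU.2.1.sub (hzx.mul hzy)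
  have hGs : ContDiffOn ℝ (⊤ : ℕ∞) G (Metric.ball q ε) := hgU.2.2.1.sub (hzy.mul hzy)
  have hpos : ∀ x ∈ Metric.ball q ε, 0 < E x ∧ 0 < E x * G x - F x ^ 2 := by
    intro x hx
    obtain ⟨h11, hd⟩ := hgU.2.2.2 x hx
    have hw : 0 < gdet g11 g12 g22 x * (1 - gradSq g11 g12 g22 z x) :=
      mul_pos hd (sub_pos.2 (hgrad x (hball hx)))
    have hs := gradSq_mul_gdet z hd.ne'
    have hdet : gdet g11 g12 g22 x = g11 x * g22 x - g12 x ^ 2 := rfl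
    refine ⟨pos_of_mul_pos_right (a := gdet g11 g12 g22 x) ?_ hd.le, ?_⟩
    · have h : gdet g11 g12 g22 x * E x =
          g11 x * (gdet g11 g12 g22 x * (1 - gradSq g11 g12 g22 z x))
            + (g11 x * pd 1 z x - g12 x * pd 0 z x) ^ 2 := by
        simp only [hE]
        linear_combination g11 x * hs - pd 0 z x ^ 2 * hdet
      rw [h]
      positivity
    · have h : E x * G x - F x ^ 2 =
          gdet g11 g12 g22 x * (1 - gradSq g11 g12 g22 z x) := by
        simp only [hE, hF, hG]
        linear_combination hs - hdet
      rwa [h]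
  set a : ℝ × ℝ → ℝ := fun x => √(E x)
  set b : ℝ × ℝ → ℝ := fun x => F x / a x with hbdef
  set c : ℝ × ℝ → ℝ := fun x => √(E x * G x - F x ^ 2) / a x with hcdef
  have ha0 : ∀ x ∈ Metric.ball q ε, a x ≠ 0 := fun x hx => (Real.sqrt_pos.2 (hpos x hx).1).ne'
  have hc0 : ∀ x ∈ Metric.ball q ε, c x ≠ 0 := fun x hx =>
    div_ne_zero (Real.sqrt_pos.2 (hpos x hx).2).ne' (ha0 x hx)
  have ha : ContDiffOn ℝ (⊤ : ℕ∞) a (Metric.ball q ε) :=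
    hEs.sqrt fun x hx => (hpos x hx).1.ne'
  have hb : ContDiffOn ℝ (⊤ : ℕ∞) b (Metric.ball q ε) := hFs.div ha ha0
  have hc : ContDiffOn ℝ (⊤ : ℕ∞) c (Metric.ball q ε) :=
    (((hEs.mul hGs).sub (hFs.pow 2)).sqrt fun x hx => (hpos x hx).2.ne').div ha ha0
  have haa : ∀ x ∈ Metric.ball q ε, a x * a x = E x :=
    fun x hx => Real.mul_self_sqrt (hpos x hx).1.le
  have hab : ∀ x ∈ Metric.ball q ε, a x * b x = F x :=
    fun x hx => mul_div_cancel₀ _ (ha0 x hx)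
  have hbc : ∀ x ∈ Metric.ball q ε, b x * b x + c x * c x = G x := by
    intro x hx
    rw [hbdef, hcdef]
    simp only [div_mul_div_comm, haa x hx, Real.mul_self_sqrt (hpos x hx).2.le]
    have := (hpos x hx).1.ne'
    field_simp
    ring
  set P : ℝ × ℝ → ℝ := fun x => (pd 0 b x - pd 1 a x) / c x
  set Q : ℝ × ℝ → ℝ := fun x => (pd 0 c x + P x * b x) / a x
  have hP : ContDiffOn ℝ (⊤ : ℕ∞) P (Metric.ball q ε) :=
    ((hb.pd hU 0).sub (ha.pd hU 1)).div hc hc0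
  have hQ : ContDiffOn ℝ (⊤ : ℕ∞) Q (Metric.ball q ε) :=
    ((hc.pd hU 0).add (hP.mul hb)).div ha ha0
  have hPc : ∀ x ∈ Metric.ball q ε, P x * c x = pd 0 b x - pd 1 a x :=
    fun x hx => div_mul_cancel₀ _ (hc0 x hx)
  have hQa : ∀ x ∈ Metric.ball q ε, Q x * a x = pd 0 c x + P x * b x :=
    fun x hx => div_mul_cancel₀ _ (ha0 x hx)
  have h11 : ∀ x ∈ Metric.ball q ε, g11 x = a x * a x + pd 0 z x * pd 0 z x :=
    fun x hx => by rw [haa x hx]; simp [hE]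
  have h12 : ∀ x ∈ Metric.ball q ε, g12 x = a x * b x + pd 0 z x * pd 1 z x :=
    fun x hx => by rw [hab x hx]; simp [hF]
  have h22 : ∀ x ∈ Metric.ball q ε, g22 x = b x * b x + c x * c x + pd 1 z x * pd 1 z x :=
    fun x hx => by rw [hbc x hx]; simp [hG]
  obtain ⟨u, v, hu, hv, huv⟩ := exists_isometry_of_connection_closed hU (convex_ball q ε)
    ha hb hc hP hQ hPc hQa (connection_closed_of_darboux hU hgU hzU ha hb hc ha0 hc0 h11 h12 h22
      (fun x hx => hD x (hball hx)) hP hQ hPc hQa)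
  refine ⟨u, v, hU, Metric.mem_ball_self hε, hball, hu, hv, fun p hp i j => ?_⟩
  obtain ⟨k1, k2, k3⟩ := huv p hp
  fin_cases i <;> fin_cases j <;> simp only [gmat, Fin.zero_eta, Fin.mk_one, if_true, one_ne_zero,
    if_false]
  · rw [h11 p hp, k1]
  · rw [h12 p hp, k2]
  · linear_combination k2 - h12 p hp
  · rw [h22 p hp, k3]

end
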